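/- Let S(t) = sin(πt)/(πt) for t ≠ 0 and S(0) = 1, let DS(t) = S'(t) be its derivative, and let IS(t) = ∫_0^t S(u) du. Define the 2×2 matrix kernel K₄(x,y) = (1/2)·[[−IS(x−y), S(x−y)], [−S(x−y), DS(x−y)]]. For points x₁,…,xₙ ∈ ℝ let M be the (2n)×(2n) antisymmetric block matrix whose (i,j) block is K₄(x_i,x_j). Then there exists a constant B > 0 such that for every a ∈ ℝ, every n ≥ 1, and all x₁,…,xₙ ∈ [a, a+1], |det M(x₁,…,xₙ)| ≤ exp(B·n² − n²·log n). -/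

import Mathlib

noncomputable def sinc (t : ℝ) : ℝ :=
  if t = 0 then 1 else Real.sin (Real.pi * t) / (Real.pi * t)

noncomputable def K4 (x y : ℝ) : Matrix (Fin 2) (Fin 2) ℝ :=
  (1 / 2 : ℝ) • !![-(∫ u in (0 : ℝ)..(x - y), sinc u), sinc (x - y);
                   -(sinc (x - y)), deriv sinc (x - y)]

lemma aux_det_le {ι : Type*} [Fintype ι] [DecidableEq ι] (A : Matrix ι ι ℝ) (b : ι → ℝ)
    (h : ∀ i j, |A i j| ≤ b i) : |A.det| ≤ (Fintype.card ι).factorial * ∏ i, b i := by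
  rw [← Matrix.det_transpose, Matrix.det_apply]
  refine (Finset.abs_sum_le_sum_abs _ _).trans ?_
  have : ∀ σ ∈ (Finset.univ : Finset (Equiv.Perm ι)),
      |Equiv.Perm.sign σ • ∏ i, A.transpose (σ i) i| ≤ ∏ i, b i := by
    intro σ _
    have h1 : |Equiv.Perm.sign σ • ∏ i, A.transpose (σ i) i| = ∏ i, |A i (σ i)| := by
      rcases Int.units_eq_one_or (Equiv.Perm.sign σ) with h | h <;>
        simp [h, Finset.abs_prod, Matrix.transpose_apply]
    rw [h1]
    exact Finset.prod_le_prod (fun _ _ => abs_nonneg _) (fun i _ => h i _)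
  refine (Finset.sum_le_sum this).trans ?_
  simp [Fintype.card_perm]

lemma aux_low_rank {ι : Type*} [Fintype ι] [DecidableEq ι] (P R : Matrix ι ι ℝ) (d r : ℕ)
    (c : Fin d → ι → ℝ) (hP : ∀ i, P i ∈ Submodule.span ℝ (Set.range c)) (a δ : ℝ)
    (ha : 0 ≤ a) (hδ : 0 ≤ δ) (hδ1 : δ ≤ 1) (hPb : ∀ i j, |P i j| ≤ a)
    (hRb : ∀ i j, |R i j| ≤ a * δ) (hr : r + d ≤ Fintype.card ι) :
    |(P + R).det| ≤ 2 ^ (Fintype.card ι) *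
      ((Fintype.card ι).factorial * (a ^ (Fintype.card ι) * δ ^ r)) := by
  have h0 : (P + R).det = ∑ s : Finset ι, Matrix.det (s.piecewise P R : Matrix ι ι ℝ) :=
    MultilinearMap.map_add_univ (Matrix.detRowAlternating (n := ι) (R := ℝ)).toMultilinearMap P R
  rw [h0]
  refine (Finset.abs_sum_le_sum_abs _ _).trans ?_
  have key : ∀ s ∈ (Finset.univ : Finset (Finset ι)),
      |Matrix.det (s.piecewise P R : Matrix ι ι ℝ)| ≤
        (Fintype.card ι).factorial * (a ^ (Fintype.card ι) * δ ^ r) := by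
    intro s _
    by_cases hs : s.card ≤ d
    · refine (aux_det_le _ (fun i => if i ∈ s then a else a * δ) ?_).trans ?_
      · intro i j
        by_cases hi : i ∈ s
        · simpa [Finset.piecewise, hi] using hPb i j
        · simpa [Finset.piecewise, hi] using hRb i j
      · gcongr
        have : ∀ i, (if i ∈ s then a else a * δ) = a * (if i ∈ s then 1 else δ) := by
          intro i; split_ifs <;> simp
        simp_rw [this]
        rw [Finset.prod_mul_distrib, Finset.prod_ite]
        simp only [Finset.prod_const, one_pow, one_mul, Finset.card_univ]
        gcongr 1
        apply pow_le_pow_of_le_one hδ hδ1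
        have : (Finset.univ.filter (fun i => i ∉ s)) = sᶜ := by ext; simp
        rw [this, Finset.card_compl]
        omega
    · have : Matrix.det (s.piecewise P R : Matrix ι ι ℝ) = 0 := by
        by_contra hne
        have hu : IsUnit (Matrix.of (s.piecewise P R) : Matrix ι ι ℝ) := by
          rw [Matrix.isUnit_iff_isUnit_det]; exact isUnit_iff_ne_zero.mpr hne
        have hli := Matrix.linearIndependent_rows_iff_isUnit.mpr hu
        have hli2 := hli.comp (fun i : s => (i : ι)) Subtype.val_injective
        have hmem : ∀ i : s, (Matrix.row (Matrix.of (s.piecewise P R) : Matrix ι ι ℝ) ∘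
            (fun i : s => (i : ι))) i ∈ Submodule.span ℝ (Set.range c) := by
          intro i
          have : (Matrix.row (Matrix.of (s.piecewise P R) : Matrix ι ι ℝ) ∘
            (fun i : s => (i : ι))) i = P i := by
            exact Finset.piecewise_eq_of_mem s P R i.2
          rw [this]; exact hP i
        have hli3 : LinearIndependent ℝ (fun i : s =>
            (⟨_, hmem i⟩ : Submodule.span ℝ (Set.range c))) := by
          apply LinearIndependent.of_comp (Submodule.span ℝ (Set.range c)).subtype
          exact hli2
        have h1 := hli3.fintype_card_le_finrank
        have h2 := finrank_range_le_card (R := ℝ) c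
        simp only [Set.finrank, Fintype.card_coe, Fintype.card_fin] at h1 h2
        omega
      rw [this, abs_zero]
      positivity
  refine (Finset.sum_le_sum key).trans ?_
  simp

lemma aux_fact (i j : ℕ) : ((i.factorial : ℝ) * j.factorial) ≤ ((i + j).factorial : ℝ) := by
  exact_mod_cast Nat.le_of_dvd (Nat.factorial_pos _)
    (Nat.factorial_mul_factorial_dvd_factorial_add i j)

lemma aux_tail (r s : ℝ) (e M : ℕ)
    (h : HasSum (fun n => (-1 : ℝ) ^ n * r ^ (2 * n + e) / ((2 * n + e).factorial : ℝ)) s) :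
    |s - ∑ m ∈ Finset.range M, (-1 : ℝ) ^ m * r ^ (2 * m + e) / ((2 * m + e).factorial : ℝ)| ≤
      |r| ^ (2 * M + e) / ((2 * M + e).factorial : ℝ) * Real.cosh r := by
  have h1 := (hasSum_nat_add_iff' M).mpr h
  have h2 := (Real.hasSum_cosh r).mul_left (|r| ^ (2 * M + e) / ((2 * M + e).factorial : ℝ))
  rw [← h1.tsum_eq, ← Real.norm_eq_abs]
  refine tsum_of_norm_bounded h2 ?_
  intro n
  have hr : r ^ (2 * n) = |r| ^ (2 * n) := by rw [pow_mul, pow_mul, sq_abs]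
  rw [hr, norm_div, norm_mul, norm_pow, norm_pow]
  simp only [norm_neg, norm_one, one_pow, one_mul, Real.norm_eq_abs, Nat.abs_cast]
  rw [div_mul_div_comm, ← pow_add]
  have he : 2 * (n + M) + e = 2 * M + e + 2 * n := by ring
  rw [he]
  gcongr
  exact aux_fact _ _

lemma sinc_eq (t : ℝ) : sinc t = Real.sinc (Real.pi * t) := by
  unfold sinc Real.sinc
  by_cases h : t = 0 <;> simp [h, Real.pi_ne_zero]

lemma sinc_cont : Continuous sinc := by
  have : sinc = fun t => Real.sinc (Real.pi * t) := funext sinc_eq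
  rw [this]
  exact Real.continuous_sinc.comp (by fun_prop)

lemma deriv_sinc_zero : deriv sinc 0 = 0 := by
  have h := deriv_comp_neg sinc 0
  have : (fun x => sinc (-x)) = sinc := by
    funext x; simp [sinc_eq]
  rw [this, neg_zero] at h
  linarith

lemma deriv_sinc_mul (t : ℝ) (ht : t ≠ 0) :
    t * deriv sinc t = Real.cos (Real.pi * t) - sinc t := by
  have hpi := Real.pi_ne_zero
  have h1 : HasDerivAt (fun t : ℝ => Real.pi * t) Real.pi t := by
    simpa using (hasDerivAt_id t).const_mul Real.pi
  have h2 := (h1.sin).div h1 (mul_ne_zero hpi ht)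
  have h3 : sinc =ᶠ[nhds t] fun t => Real.sin (Real.pi * t) / (Real.pi * t) := by
    filter_upwards [isOpen_ne.mem_nhds ht] with x hx
    simp [sinc, show x ≠ 0 from hx]
  rw [(h2.congr_of_eventuallyEq h3).deriv]
  simp only [sinc, ht, if_false]
  field_simp

/-- Truncated Taylor polynomial of the integrated sine kernel. -/
noncomputable def pol (M : ℕ) : Polynomial ℝ :=
  ∑ m ∈ Finset.range M, Polynomial.monomial (2 * m + 1)
    ((-1 : ℝ) ^ m * Real.pi ^ (2 * m) / ((2 * m + 1) * ((2 * m + 1).factorial : ℝ)))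

lemma pol_deg (M : ℕ) (hM : 1 ≤ M) : (pol M).natDegree < 2 * M := by
  have : (pol M).natDegree ≤ 2 * M - 1 := by
    apply Polynomial.natDegree_sum_le_of_forall_le
    intro m hm
    have := Finset.mem_range.mp hm
    exact (Polynomial.natDegree_monomial_le _).trans (by omega)
  omega

lemma pol_zero (M : ℕ) : (pol M).eval 0 = 0 := by
  simp [pol, Polynomial.eval_finsetSum]

lemma pol_der (M : ℕ) (t : ℝ) : (Polynomial.derivative (pol M)).eval t =
    ∑ m ∈ Finset.range M, (-1 : ℝ) ^ m * (Real.pi * t) ^ (2 * m) / ((2 * m + 1).factorial : ℝ) := by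
  simp only [pol, Polynomial.derivative_sum, Polynomial.eval_finsetSum,
    Polynomial.derivative_monomial, Polynomial.eval_monomial]
  refine Finset.sum_congr rfl fun m _ => ?_
  have : (2 * (m : ℝ) + 1) ≠ 0 := by positivity
  rw [Nat.add_sub_cancel]
  push_cast
  field_simp
  rw [mul_pow]

lemma pol_der2_zero (M : ℕ) :
    (Polynomial.derivative (Polynomial.derivative (pol M))).eval 0 = 0 := by
  simp only [pol, Polynomial.derivative_sum, Polynomial.eval_finsetSum,
    Polynomial.derivative_monomial, Polynomial.eval_monomial]
  refine Finset.sum_eq_zero fun m _ => ?_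
  rcases m with _ | m
  · simp
  · have : 2 * (m + 1) + 1 - 1 - 1 ≠ 0 := by omega
    rw [zero_pow this, mul_zero]

lemma pol_der2 (M : ℕ) (t : ℝ) :
    t * (Polynomial.derivative (Polynomial.derivative (pol M))).eval t =
    ∑ m ∈ Finset.range M, (-1 : ℝ) ^ m * (Real.pi * t) ^ (2 * m + 0) / ((2 * m + 0).factorial : ℝ)
      - (Polynomial.derivative (pol M)).eval t := by
  rw [pol_der]
  simp only [pol, Polynomial.derivative_sum, Polynomial.eval_finsetSum,
    Polynomial.derivative_monomial, Polynomial.eval_monomial]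
  rw [Finset.mul_sum, ← Finset.sum_sub_distrib]
  refine Finset.sum_congr rfl fun m _ => ?_
  have h1 : (2 * (m : ℝ) + 1) ≠ 0 := by positivity
  have hf : ((2 * m).factorial : ℝ) ≠ 0 := by positivity
  rcases m with _ | m
  · simp
  · have e1 : 2 * (m + 1) + 1 - 1 - 1 = 2 * m + 1 := by omega
    have e2 : 2 * (m + 1) + 1 - 1 = 2 * (m + 1) := by omega
    rw [e1, e2, Nat.factorial_succ (2 * (m + 1)), add_zero]
    push_cast at *
    field_simp
    ring

/-- error bound -/
noncomputable def err (M : ℕ) : ℝ :=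
  2 * Real.cosh Real.pi * Real.pi ^ (2 * M) / ((2 * M).factorial : ℝ)

lemma aux_cos (M : ℕ) (hM : 1 ≤ M) (t : ℝ) (ht : |t| ≤ 1) :
    |Real.cos (Real.pi * t) - ∑ m ∈ Finset.range M, (-1 : ℝ) ^ m * (Real.pi * t) ^ (2 * m + 0) /
      ((2 * m + 0).factorial : ℝ)| ≤ |t| * (err M / 2) := by
  refine (aux_tail _ _ 0 M (by simpa using Real.hasSum_cos (Real.pi * t))).trans ?_
  have hc : Real.cosh (Real.pi * t) ≤ Real.cosh Real.pi := by
    rw [Real.cosh_le_cosh, abs_mul, abs_of_pos Real.pi_pos]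
    exact mul_le_of_le_one_right Real.pi_pos.le ht
  have hp : |t| ^ (2 * M) ≤ |t| := by
    simpa using pow_le_pow_of_le_one (abs_nonneg t) ht (show 1 ≤ 2 * M by omega)
  rw [abs_mul, abs_of_pos Real.pi_pos, mul_pow, add_zero, err]
  calc Real.pi ^ (2 * M) * |t| ^ (2 * M) / ((2 * M).factorial : ℝ) * Real.cosh (Real.pi * t)
      ≤ Real.pi ^ (2 * M) * |t| / ((2 * M).factorial : ℝ) * Real.cosh Real.pi := by gcongr
    _ = _ := by ring

lemma aux_sinc (M : ℕ) (hM : 1 ≤ M) (t : ℝ) (ht : |t| ≤ 1) :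
    |sinc t - (Polynomial.derivative (pol M)).eval t| ≤ |t| * (err M / 2) := by
  by_cases h0 : t = 0
  · subst h0
    rw [pol_der]
    obtain ⟨k, rfl⟩ : ∃ k, M = k + 1 := ⟨M - 1, by omega⟩
    rw [Finset.sum_range_succ']
    simp [sinc]
  have hpi := Real.pi_pos
  have h := aux_tail (Real.pi * t) _ 1 M (Real.hasSum_sin (Real.pi * t))
  have hc : Real.cosh (Real.pi * t) ≤ Real.cosh Real.pi := by
    rw [Real.cosh_le_cosh, abs_mul, abs_of_pos Real.pi_pos]
    exact mul_le_of_le_one_right Real.pi_pos.le ht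
  have hp : |t| ^ (2 * M) ≤ |t| := by
    simpa using pow_le_pow_of_le_one (abs_nonneg t) ht (show 1 ≤ 2 * M by omega)
  have hr : Real.pi * t ≠ 0 := mul_ne_zero hpi.ne' h0
  have heq : sinc t - (Polynomial.derivative (pol M)).eval t = (Real.sin (Real.pi * t) -
      ∑ m ∈ Finset.range M, (-1 : ℝ) ^ m * (Real.pi * t) ^ (2 * m + 1) /
      ((2 * m + 1).factorial : ℝ)) / (Real.pi * t) := by
    rw [pol_der, sub_div, Finset.sum_div]
    simp only [sinc, h0, if_false]
    congr 1
    refine Finset.sum_congr rfl fun m _ => ?_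
    rw [pow_succ]
    generalize Real.pi * t = r at *
    field_simp
  have hra : 0 < |Real.pi * t| := abs_pos.mpr hr
  rw [heq, abs_div, div_le_iff₀ hra]
  refine h.trans ?_
  rw [pow_succ, abs_mul, abs_of_pos Real.pi_pos, mul_pow, err]
  have hf : ((2 * M).factorial : ℝ) ≤ ((2 * M + 1).factorial : ℝ) := by
    exact_mod_cast Nat.factorial_le (by omega)
  calc Real.pi ^ (2 * M) * |t| ^ (2 * M) * (Real.pi * |t|) / ((2 * M + 1).factorial : ℝ)
        * Real.cosh (Real.pi * t)
      ≤ Real.pi ^ (2 * M) * |t| * (Real.pi * |t|) / ((2 * M).factorial : ℝ)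
        * Real.cosh Real.pi := by gcongr
    _ = _ := by ring

lemma err_pos (M : ℕ) : 0 < err M := by
  have := Real.pi_pos
  have := Real.cosh_pos Real.pi
  unfold err; positivity

lemma aux_S (M : ℕ) (hM : 1 ≤ M) (t : ℝ) (ht : |t| ≤ 1) :
    |sinc t - (Polynomial.derivative (pol M)).eval t| ≤ err M := by
  have := aux_sinc M hM t ht
  nlinarith [err_pos M, abs_nonneg t]

lemma aux_DS (M : ℕ) (hM : 1 ≤ M) (t : ℝ) (ht : |t| ≤ 1) :
    |deriv sinc t - (Polynomial.derivative (Polynomial.derivative (pol M))).eval t| ≤ err M := by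
  by_cases h0 : t = 0
  · subst h0
    rw [deriv_sinc_zero, pol_der2_zero]
    simpa using (err_pos M).le
  have h1 := aux_sinc M hM t ht
  have h2 := aux_cos M hM t ht
  have ha : 0 < |t| := abs_pos.mpr h0
  refine le_of_mul_le_mul_left ?_ ha
  rw [← abs_mul, mul_sub, pol_der2, deriv_sinc_mul t h0]
  rw [abs_le] at *
  constructor <;> linarith [h1.1, h1.2, h2.1, h2.2]

lemma aux_IS (M : ℕ) (hM : 1 ≤ M) (t : ℝ) (ht : |t| ≤ 1) :
    |(∫ u in (0 : ℝ)..t, sinc u) - (pol M).eval t| ≤ err M := by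
  have h1 : ∫ u in (0 : ℝ)..t, (Polynomial.derivative (pol M)).eval u = (pol M).eval t := by
    rw [intervalIntegral.integral_eq_sub_of_hasDerivAt (f := fun u => (pol M).eval u)
      (fun x _ => (pol M).hasDerivAt x)
      ((Polynomial.derivative (pol M)).continuous.intervalIntegrable _ _), pol_zero, sub_zero]
  rw [← h1, ← intervalIntegral.integral_sub (sinc_cont.intervalIntegrable _ _)
    ((Polynomial.derivative (pol M)).continuous.intervalIntegrable _ _)]
  rw [← Real.norm_eq_abs]
  refine (intervalIntegral.norm_integral_le_of_norm_le_const (C := err M) ?_).trans ?_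
  · intro x hx
    apply aux_S M hM
    have := Set.uIoc_subset_uIcc hx
    have h3 := Set.abs_sub_left_of_mem_uIcc this
    simp only [sub_zero] at h3
    linarith
  · rw [sub_zero]
    exact mul_le_of_le_one_right (err_pos M).le ht

/-- polynomial replacement of the kernel -/
noncomputable def KP (M : ℕ) (x y : ℝ) : Matrix (Fin 2) (Fin 2) ℝ :=
  (1 / 2 : ℝ) • !![-((pol M).eval (x - y)), (Polynomial.derivative (pol M)).eval (x - y);
    -((Polynomial.derivative (pol M)).eval (x - y)),
      (Polynomial.derivative (Polynomial.derivative (pol M))).eval (x - y)]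

lemma KP_err (M : ℕ) (hM : 1 ≤ M) (x y : ℝ) (h : |x - y| ≤ 1) (i j : Fin 2) :
    |K4 x y i j - KP M x y i j| ≤ err M := by
  have h1 := aux_S M hM _ h
  have h2 := aux_DS M hM _ h
  have h3 := aux_IS M hM _ h
  have h4 := err_pos M
  rw [abs_le] at *
  fin_cases i <;> fin_cases j <;> simp [K4, KP] <;> constructor <;>
    linarith [h1.1, h1.2, h2.1, h2.2, h3.1, h3.2]

lemma KP_one (x y : ℝ) (h : |x - y| ≤ 1) (i j : Fin 2) : |KP 1 x y i j| ≤ 1 := by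
  rw [abs_le] at *
  fin_cases i <;> fin_cases j <;>
    simp [KP, pol, ← Polynomial.C_mul_X_pow_eq_monomial] <;>
    (try constructor) <;> linarith [h.1, h.2]

lemma K4_le (x y : ℝ) (h : |x - y| ≤ 1) (i j : Fin 2) : |K4 x y i j| ≤ 1 + err 1 := by
  have h1 := KP_err 1 le_rfl x y h i j
  have h2 := KP_one x y h i j
  rw [abs_le] at *
  constructor <;> linarith [h1.1, h1.2, h2.1, h2.2]

/-- column polynomials -/
noncomputable def colp (M : ℕ) (y : ℝ) (j : Fin 2) : Polynomial ℝ :=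
  Polynomial.C (1 / 2 : ℝ) * (if j = 0 then -((pol M).comp (Polynomial.X - Polynomial.C y)) else
    (Polynomial.derivative (pol M)).comp (Polynomial.X - Polynomial.C y))

lemma comp_deg (p : Polynomial ℝ) (y : ℝ) :
    (p.comp (Polynomial.X - Polynomial.C y)).natDegree ≤ p.natDegree := by
  refine Polynomial.natDegree_comp_le.trans ?_
  simp

lemma colp_deg (M : ℕ) (hM : 1 ≤ M) (y : ℝ) (j : Fin 2) : (colp M y j).natDegree < 2 * M := by
  have h := pol_deg M hM
  refine lt_of_le_of_lt (Polynomial.natDegree_C_mul_le _ _) ?_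
  split_ifs
  · rw [Polynomial.natDegree_neg]
    exact (comp_deg _ _).trans_lt h
  · exact (comp_deg _ _).trans_lt (((pol M).natDegree_derivative_le).trans_lt (by omega))

lemma KP_zero_eq (M : ℕ) (x y : ℝ) (j : Fin 2) : KP M x y 0 j = (colp M y j).eval x := by
  fin_cases j <;> simp [KP, colp]

lemma KP_one_eq (M : ℕ) (x y : ℝ) (j : Fin 2) :
    KP M x y 1 j = (Polynomial.derivative (colp M y j)).eval x := by
  fin_cases j <;> simp [KP, colp, Polynomial.derivative_comp]

lemma der_sum (p : Polynomial ℝ) (d : ℕ) (h : p.natDegree < d) (x : ℝ) :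
    (Polynomial.derivative p).eval x =
      ∑ k : Fin d, ((k : ℕ) * x ^ ((k : ℕ) - 1)) * p.coeff k := by
  conv_lhs => rw [p.as_sum_range' d h]
  simp only [Polynomial.derivative_sum, Polynomial.eval_finsetSum,
    Polynomial.derivative_monomial, Polynomial.eval_monomial]
  rw [Finset.sum_range]
  refine Finset.sum_congr rfl fun k _ => ?_
  ring

lemma KP_span (M : ℕ) (hM : 1 ≤ M) (n : ℕ) (x : Fin n → ℝ) (p : Fin n × Fin 2) :
    (fun q : Fin n × Fin 2 => KP M (x p.1) (x q.1) p.2 q.2) ∈ Submodule.span ℝ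
      (Set.range (fun k : Fin (2 * M) => fun q : Fin n × Fin 2 => (colp M (x q.1) q.2).coeff k)) := by
  obtain ⟨i, e⟩ := p
  have : ∃ A : Fin (2 * M) → ℝ, (fun q : Fin n × Fin 2 => KP M (x i) (x q.1) e q.2) =
      ∑ k, A k • (fun q : Fin n × Fin 2 => (colp M (x q.1) q.2).coeff k) := by
    fin_cases e
    · refine ⟨fun k => x i ^ (k : ℕ), ?_⟩
      funext q
      have := Polynomial.eval_eq_sum_range' (colp_deg M hM (x q.1) q.2) (x i)
      rw [Finset.sum_range] at this
      simp [Finset.sum_apply, KP_zero_eq, this, mul_comm]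
    · refine ⟨fun k => (k : ℕ) * x i ^ ((k : ℕ) - 1), ?_⟩
      funext q
      simp [Finset.sum_apply, KP_one_eq, der_sum _ _ (colp_deg M hM (x q.1) q.2) (x i)]
  obtain ⟨A, hA⟩ := this
  simp only at *
  rw [hA]
  exact Submodule.sum_mem _ fun k _ => Submodule.smul_mem _ _ (Submodule.subset_span ⟨k, rfl⟩)

/-- basic constant -/
noncomputable def LL : ℝ := 1 + err 1 + 2 * Real.cosh Real.pi * Real.pi ^ 2

lemma err_le (n : ℕ) (hn : 1 ≤ n) :
    err ((n + 1) / 2) ≤ (2 * Real.cosh Real.pi * Real.pi ^ 2) ^ n * (1 / (n.factorial : ℝ)) := by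
  have hpi : 1 ≤ Real.pi := by linarith [Real.pi_gt_three]
  have hc : 1 ≤ Real.cosh Real.pi := Real.one_le_cosh _
  have hf : (n.factorial : ℝ) ≤ ((2 * ((n + 1) / 2)).factorial : ℝ) := by
    exact_mod_cast Nat.factorial_le (by omega)
  have hp : Real.pi ^ (2 * ((n + 1) / 2)) ≤ Real.pi ^ (2 * n) :=
    pow_le_pow_right₀ hpi (by omega)
  have h2 : 2 * Real.cosh Real.pi ≤ (2 * Real.cosh Real.pi) ^ n :=
    le_self_pow₀ (by linarith) (by omega)
  rw [err, mul_pow _ _ n, ← pow_mul, mul_one_div]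
  gcongr

theorem main_bound (a : ℝ) (n : ℕ) (hn : 1 ≤ n) (x : Fin n → ℝ)
    (hx : ∀ i, x i ∈ Set.Icc a (a + 1)) :
    |(Matrix.of fun p q : Fin n × Fin 2 => K4 (x p.1) (x q.1) p.2 q.2).det| ≤
      2 ^ (n * 2) * ((n * 2).factorial * ((LL ^ n) ^ (n * 2) * (1 / (n.factorial : ℝ)) ^ (n - 1))) := by
  have hM : 1 ≤ (n + 1) / 2 := by omega
  set M := (n + 1) / 2 with hMdef
  set C := 2 * Real.cosh Real.pi * Real.pi ^ 2 with hC
  have hpi : 0 < Real.pi := Real.pi_pos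
  have hch := Real.cosh_pos Real.pi
  have hC0 : 0 < C := by positivity
  have he := err_le n hn
  have he1 := err_pos 1
  have hfac : (1 : ℝ) ≤ n.factorial := by exact_mod_cast Nat.factorial_pos n
  have hδ1 : 1 / (n.factorial : ℝ) ≤ 1 := by
    rw [div_le_one (by linarith)]; exact hfac
  have hδ0 : 0 ≤ 1 / (n.factorial : ℝ) := by positivity
  have hdist : ∀ i j, |x i - x j| ≤ 1 := by
    intro i j
    have h1 := hx i
    have h2 := hx j
    rw [abs_le]; constructor <;> linarith [h1.1, h1.2, h2.1, h2.2]
  have hLC : C ≤ LL := by unfold LL; linarith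
  have hsum : 1 + err 1 + C ^ n ≤ LL ^ n := by
    have h1 : (1 + err 1) ≤ (1 + err 1) ^ n := le_self_pow₀ (by linarith) (by omega)
    have h2 := pow_add_pow_le (show 0 ≤ 1 + err 1 by linarith) hC0.le (show n ≠ 0 by omega)
    have h3 : LL = 1 + err 1 + C := rfl
    rw [h3]; linarith
  have hL0 : 0 ≤ LL := by linarith
  set P : Matrix (Fin n × Fin 2) (Fin n × Fin 2) ℝ :=
    Matrix.of fun p q => KP M (x p.1) (x q.1) p.2 q.2 with hP
  set A : Matrix (Fin n × Fin 2) (Fin n × Fin 2) ℝ :=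
    Matrix.of fun p q => K4 (x p.1) (x q.1) p.2 q.2 with hA
  have hR : ∀ p q, |(A - P) p q| ≤ C ^ n * (1 / (n.factorial : ℝ)) := fun p q =>
    (KP_err M hM _ _ (hdist _ _) _ _).trans he
  have hcard : Fintype.card (Fin n × Fin 2) = n * 2 := by simp
  have := aux_low_rank P (A - P) (2 * M) (n - 1) _ (KP_span M hM n x) (LL ^ n)
    (1 / (n.factorial : ℝ)) (by positivity) hδ0 hδ1 ?_ ?_ (by rw [hcard]; omega)
  · rwa [add_sub_cancel, hcard] at this
  · intro p q
    have h1 := hR p q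
    have h2 : |A p q| ≤ 1 + err 1 := K4_le _ _ (hdist _ _) _ _
    have h3 : C ^ n * (1 / (n.factorial : ℝ)) ≤ C ^ n :=
      mul_le_of_le_one_right (by positivity) hδ1
    rw [Matrix.sub_apply] at h1
    rw [abs_le] at *
    constructor <;> linarith [h1.1, h1.2, h2.1, h2.2]
  · intro p q
    refine (hR p q).trans ?_
    gcongr

theorem stmt17 :
    ∃ B > 0, ∀ (a : ℝ) (n : ℕ), 1 ≤ n → ∀ x : Fin n → ℝ,
      (∀ i, x i ∈ Set.Icc a (a + 1)) →
      |(Matrix.of fun p q : Fin n × Fin 2 => K4 (x p.1) (x q.1) p.2 q.2).det| ≤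
        Real.exp (B * n ^ 2 - n ^ 2 * Real.log n) := by
  refine ⟨8 + 2 * LL, ?_, ?_⟩
  · have := err_pos 1
    have := Real.cosh_pos Real.pi
    unfold LL
    positivity
  intro a n hn x hx
  refine (main_bound a n hn x hx).trans ?_
  have hL0 : 0 < LL := by
    have := err_pos 1
    have := Real.cosh_pos Real.pi
    unfold LL
    positivity
  have hn1 : (1 : ℝ) ≤ n := by exact_mod_cast hn
  have hn0 : (0 : ℝ) < n := by linarith
  have hle : ∀ y : ℝ, y ≤ Real.exp y := fun y => by linarith [Real.add_one_le_exp y]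
  have b1 : (2 : ℝ) ^ (n * 2) ≤ Real.exp (2 * n ^ 2) := by
    calc (2 : ℝ) ^ (n * 2) ≤ (Real.exp 1) ^ (n * 2) := by
          gcongr; linarith [Real.add_one_le_exp (1 : ℝ)]
      _ = Real.exp (n * 2) := by rw [← Real.exp_nat_mul]; push_cast; ring_nf
      _ ≤ _ := by apply Real.exp_le_exp.mpr; nlinarith
  have b2 : ((n * 2).factorial : ℝ) ≤ Real.exp (4 * n ^ 2) := by
    calc ((n * 2).factorial : ℝ) ≤ ((n * 2 : ℕ) : ℝ) ^ (n * 2) := by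
          exact_mod_cast Nat.factorial_le_pow _
      _ ≤ (Real.exp ((n * 2 : ℕ) : ℝ)) ^ (n * 2) := by gcongr; exact hle _
      _ = _ := by rw [← Real.exp_nat_mul]; push_cast; ring_nf
  have b3 : (LL ^ n) ^ (n * 2) ≤ Real.exp (2 * LL * n ^ 2) := by
    calc (LL ^ n) ^ (n * 2) ≤ ((Real.exp LL) ^ n) ^ (n * 2) := by gcongr; exact hle _
      _ = _ := by rw [← Real.exp_nat_mul, ← Real.exp_nat_mul]; push_cast; ring_nf
  have hfac : (0 : ℝ) < n.factorial := by exact_mod_cast Nat.factorial_pos n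
  have b4 : (1 / (n.factorial : ℝ)) ^ (n - 1) = (1 / (n.factorial : ℝ)) ^ n * n.factorial := by
    obtain ⟨k, rfl⟩ : ∃ k, n = k + 1 := ⟨n - 1, by omega⟩
    rw [Nat.add_sub_cancel, pow_succ]
    field_simp
  have b5 : (n.factorial : ℝ) ≤ Real.exp (n ^ 2) := by
    calc (n.factorial : ℝ) ≤ (n : ℝ) ^ n := by exact_mod_cast Nat.factorial_le_pow _
      _ ≤ (Real.exp n) ^ n := by gcongr; exact hle _
      _ = _ := by rw [← Real.exp_nat_mul]; ring_nf
  have b6 : 1 / (n.factorial : ℝ) ≤ Real.exp (n - n * Real.log n) := by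
    have h := Real.pow_div_factorial_le_exp n hn0.le n
    rw [Real.exp_sub, Real.exp_nat_mul, Real.exp_log hn0, le_div_iff₀ (by positivity)]
    calc _ = (n : ℝ) ^ n / n.factorial := by ring
      _ ≤ _ := h
  have b7 : (1 / (n.factorial : ℝ)) ^ n ≤ Real.exp (n ^ 2 - n ^ 2 * Real.log n) := by
    calc (1 / (n.factorial : ℝ)) ^ n ≤ (Real.exp (n - n * Real.log n)) ^ n := by gcongr
      _ = _ := by rw [← Real.exp_nat_mul]; ring_nf
  rw [b4]
  calc _ ≤ Real.exp (2 * n ^ 2) * (Real.exp (4 * n ^ 2) * (Real.exp (2 * LL * n ^ 2) *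
        (Real.exp (n ^ 2 - n ^ 2 * Real.log n) * Real.exp (n ^ 2)))) := by gcongr
    _ = _ := by
      simp only [← Real.exp_add]
      ring_nf
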